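/- Let n ≥ 1 be odd and let θ and φ be cyclically ordered real n-tuples. Then, as r → 0 within (0,1), r^{−((n²−1)/4 + 1/2)} · D_n(1/2, r; θ, φ) converges to π^{−n} · 2cos(c/2) · V(θ) · V(φ). -/

import Mathlib

open scoped BigOperators

/-- Hyperbolic secant. -/
noncomputable def sech (t : ℝ) : ℝ := 1 / Real.cosh t

/-- The general term of the annulus determinant series: for a strictly increasing integer
tuple `k`, the product of the two Fourier determinants and the `sech` factors. -/
noncomputable def annulusTerm (n : ℕ) (β r : ℝ) (θ φ : Fin n → ℝ) (k : Fin n → ℤ) : ℂ :=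
  (Matrix.of fun i j : Fin n =>
      Complex.exp (Complex.I * ((β : ℂ) - (k i : ℂ)) * (θ j : ℂ))).det *
  (Matrix.of fun i j : Fin n =>
      Complex.exp (-Complex.I * ((β : ℂ) - (k i : ℂ)) * (φ j : ℂ))).det *
  ∏ i : Fin n, ((sech (Real.log (1 / r) * (β - (k i : ℝ))) : ℝ) : ℂ)

/-- The annulus determinant `D_n(β, r; θ, φ)`, summed over all strictly increasing
integer `n`-tuples. -/
noncomputable def annulusD (n : ℕ) (β r : ℝ) (θ φ : Fin n → ℝ) : ℂ :=
  ((2 * Real.pi : ℝ) : ℂ)⁻¹ ^ n *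
    ∑' k : {k : Fin n → ℤ // StrictMono k}, annulusTerm n β r θ φ k.1

/-- `V(θ) = ∏_{i<j} |exp(𝑖θ_j) − exp(𝑖θ_i)|`. -/
noncomputable def Vprod (n : ℕ) (θ : Fin n → ℝ) : ℝ :=
  ∏ p ∈ Finset.univ.filter (fun p : Fin n × Fin n => p.1 < p.2),
    ‖Complex.exp (Complex.I * (θ p.2 : ℂ)) - Complex.exp (Complex.I * (θ p.1 : ℂ))‖

/-- A real tuple `θ` is cyclically ordered if `θ_1 < θ_2 < ⋯ < θ_n < θ_1 + 2π`. -/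
def CyclicallyOrdered {n : ℕ} (θ : Fin n → ℝ) : Prop :=
  StrictMono θ ∧ ∀ i j : Fin n, θ i < θ j + 2 * Real.pi

lemma sech_log_one_div_mul {r : ℝ} (hr : 0 < r) (x : ℝ) :
    sech (Real.log (1 / r) * x) = r ^ |x| * (2 / (1 + r ^ (2 * |x|))) := by
  have h : Real.cosh (Real.log (1 / r) * x) = Real.cosh (Real.log r * |x|) := by
    rw [← Real.cosh_abs, ← Real.cosh_abs (Real.log r * |x|)]
    simp [abs_mul]
  rw [sech, h, Real.cosh_eq, Real.rpow_def_of_pos hr, Real.rpow_def_of_pos hr,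
    show Real.log r * (2 * |x|) = Real.log r * |x| + Real.log r * |x| by ring, Real.exp_add,
    Real.exp_neg]
  have := Real.exp_pos (Real.log r * |x|)
  field_simp
  ring

lemma summable_prod_fin_of_nonneg {ι : Type*} {f : ι → ℝ} (hf : 0 ≤ f) (hs : Summable f) (n : ℕ) :
    Summable fun k : Fin n → ι => ∏ i, f (k i) := by
  induction n with
  | zero => exact Summable.of_finite
  | succ n ih =>
    have h := hs.mul_of_nonneg ih hf (fun k => Finset.prod_nonneg fun i _ => hf (k i))
    rw [← (Fin.consEquiv fun _ : Fin (n + 1) => ι).summable_iff]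
    refine h.congr fun x => ?_
    simp [Fin.consEquiv, Fin.prod_univ_succ]

lemma summable_half_rpow_abs_half_sub :
    Summable fun k : ℤ => (1 / 2 : ℝ) ^ |1 / 2 - (k : ℝ)| := by
  have hg : Summable fun n : ℕ => 2 * (1 / 2 : ℝ) ^ n := summable_geometric_two.mul_left 2
  have key (n : ℕ) (x : ℝ) (hx : (n : ℝ) - 1 ≤ |x|) : (1 / 2 : ℝ) ^ |x| ≤ 2 * (1 / 2 : ℝ) ^ n := by
    calc (1 / 2 : ℝ) ^ |x| ≤ (1 / 2 : ℝ) ^ ((n : ℝ) - 1) :=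
          Real.rpow_le_rpow_of_exponent_ge (by norm_num) (by norm_num) hx
      _ = 2 * (1 / 2 : ℝ) ^ n := by
          rw [Real.rpow_sub (by norm_num), Real.rpow_natCast, Real.rpow_one]; ring
  refine Summable.of_nat_of_neg (hg.of_nonneg_of_le (fun n => by positivity) fun n => key n _ ?_)
    (hg.of_nonneg_of_le (fun n => by positivity) fun n => key n _ ?_)
  · have := neg_abs_le (1 / 2 - ((n : ℤ) : ℝ)); push_cast at *; linarith
  · have := le_abs_self (1 / 2 - ((-(n : ℤ) : ℤ) : ℝ)); push_cast at *; linarith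

lemma sum_range_odd_centered {M : Type*} [AddCommMonoid M] (f : ℤ → M) (m : ℕ) :
    ∑ i ∈ Finset.range (2 * m + 1), f ((i : ℤ) - m) =
      f 0 + ∑ j ∈ Finset.range m, (f (j + 1) + f (-(j + 1))) := by
  induction m with
  | zero => simp
  | succ m ih =>
    rw [show 2 * (m + 1) + 1 = (2 * m + 1) + 1 + 1 by ring, Finset.sum_range_succ,
      Finset.sum_range_succ', Finset.sum_range_succ _ m, ← add_assoc, ← ih]
    have h1 : ∀ i : ℕ, ((i + 1 : ℕ) : ℤ) - (m + 1 : ℕ) = i - m := by intro i; push_cast; ring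
    have h2 : ((2 * m + 1 + 1 : ℕ) : ℤ) - (m + 1 : ℕ) = m + 1 := by push_cast; ring
    have h3 : ((0 : ℕ) : ℤ) - (m + 1 : ℕ) = -(m + 1) := by push_cast; ring
    rw [h2, h3]
    simp only [h1]
    abel

lemma sum_centered_abs (m : ℕ) (a : ℤ) :
    ∑ i : Fin (2 * m + 1), (2 * |((i : ℕ) : ℤ) - m| + (((i : ℕ) : ℤ) - m).sign * (2 * a - 1) +
      if ((i : ℕ) : ℤ) - m = 0 then 1 else 0) = 2 * m * (m + 1) + 1 := by
  rw [Fin.sum_univ_eq_sum_range (fun i : ℕ => 2 * |((i : ℕ) : ℤ) - m| +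
    (((i : ℕ) : ℤ) - m).sign * (2 * a - 1) + if ((i : ℕ) : ℤ) - m = 0 then 1 else 0),
    sum_range_odd_centered (fun j : ℤ => 2 * |j| + j.sign * (2 * a - 1) + if j = 0 then 1 else 0)]
  have h (j : ℕ) : (2 * |((j : ℤ) + 1)| + ((j : ℤ) + 1).sign * (2 * a - 1) +
      (if (j : ℤ) + 1 = 0 then 1 else 0)) + (2 * |(-((j : ℤ) + 1))| +
      (-((j : ℤ) + 1)).sign * (2 * a - 1) + (if -((j : ℤ) + 1) = 0 then 1 else 0)) =
      4 * ((j : ℤ) + 1) := by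
    rw [abs_neg, Int.sign_neg, abs_of_pos (by omega : (0 : ℤ) < j + 1), if_neg (by omega),
      if_neg (by omega)]
    ring
  simp only [h]
  induction m with
  | zero => simp
  | succ m ih =>
    rw [Finset.sum_range_succ, ← add_assoc, ih]
    push_cast; ring

lemma sub_le_sub_of_strictMono {n : ℕ} {k : Fin n → ℤ} (hk : StrictMono k) {i j : Fin n}
    (hij : i ≤ j) : ((j : ℕ) : ℤ) - (i : ℕ) ≤ k j - k i := by
  obtain ⟨i, hi⟩ := i
  obtain ⟨j, hj⟩ := j
  obtain ⟨d, rfl⟩ := Nat.exists_eq_add_of_le (show i ≤ j from hij)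
  induction d with
  | zero => simp
  | succ d ih =>
    have h1 := ih (by omega) (by simp)
    have h2 : k ⟨i + d, by omega⟩ < k ⟨i + (d + 1), hj⟩ := hk (by simp [Fin.lt_def])
    simp only at h1 ⊢
    push_cast at h1 ⊢
    omega

lemma centered_bound {m : ℕ} {k : Fin (2 * m + 1) → ℤ} (hk : StrictMono k)
    (i : Fin (2 * m + 1)) :
    2 * |((i : ℕ) : ℤ) - m| + (((i : ℕ) : ℤ) - m).sign * (2 * k ⟨m, by omega⟩ - 1) +
      (if ((i : ℕ) : ℤ) - m = 0 then 1 else 0) ≤ |2 * k i - 1| := by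
  rcases lt_trichotomy (i : ℕ) m with h | h | h
  · have h1 := sub_le_sub_of_strictMono hk (show i ≤ ⟨m, by omega⟩ from h.le)
    rw [abs_of_neg (by omega), Int.sign_eq_neg_one_of_neg (by omega), if_neg (by omega)]
    simp only at h1
    have := neg_abs_le (2 * k i - 1)
    omega
  · have hi : i = ⟨m, by omega⟩ := Fin.ext h
    rw [← hi, h]
    simp only [sub_self, abs_zero, Int.sign_zero, if_true]
    have := abs_pos.2 (show 2 * k i - 1 ≠ 0 by omega)
    omega
  · have h1 := sub_le_sub_of_strictMono hk (show ⟨m, by omega⟩ ≤ i from h.le)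
    rw [abs_of_pos (by omega), Int.sign_eq_one_of_pos (by omega), if_neg (by omega)]
    simp only at h1
    have := le_abs_self (2 * k i - 1)
    omega

lemma le_sum_abs_of_strictMono {m : ℕ} {k : Fin (2 * m + 1) → ℤ} (hk : StrictMono k) :
    2 * (m : ℤ) * (m + 1) + 1 ≤ ∑ i, |2 * k i - 1| := by
  rw [← sum_centered_abs m (k ⟨m, by omega⟩)]
  exact Finset.sum_le_sum fun i _ => centered_bound hk i

lemma sum_abs_eq_iff {m : ℕ} {k : Fin (2 * m + 1) → ℤ} (hk : StrictMono k) :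
    ∑ i, |2 * k i - 1| = 2 * (m : ℤ) * (m + 1) + 1 ↔
      (k = fun i : Fin (2 * m + 1) => -(m : ℤ) + (i : ℕ)) ∨
        k = fun i : Fin (2 * m + 1) => -(m : ℤ) + 1 + (i : ℕ) := by
  constructor
  · intro h
    rw [← sum_centered_abs m (k ⟨m, by omega⟩), eq_comm,
      Finset.sum_eq_sum_iff_of_le fun i _ => centered_bound hk i] at h
    have hm := h ⟨m, by omega⟩ (Finset.mem_univ _)
    simp only [sub_self, abs_zero, Int.sign_zero, if_true] at hm
    have ha : k ⟨m, by omega⟩ = 0 ∨ k ⟨m, by omega⟩ = 1 := by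
      generalize k ⟨m, by omega⟩ = a at hm
      rcases abs_cases (2 * a - 1) with h | h <;> omega
    have hi (i : Fin (2 * m + 1)) : k i = k ⟨m, by omega⟩ + (i : ℕ) - m := by
      have h0 := h i (Finset.mem_univ _)
      rcases lt_trichotomy (i : ℕ) m with h' | h' | h'
      · have h1 := sub_le_sub_of_strictMono hk (show i ≤ ⟨m, by omega⟩ from h'.le)
        rw [abs_of_neg (by omega), Int.sign_eq_neg_one_of_neg (by omega), if_neg (by omega)] at h0
        simp only at h1
        rw [abs_of_nonpos (by omega)] at h0
        omega
      · rw [show i = ⟨m, by omega⟩ from Fin.ext h']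
        simp
      · have h1 := sub_le_sub_of_strictMono hk (show ⟨m, by omega⟩ ≤ i from h'.le)
        rw [abs_of_pos (by omega), Int.sign_eq_one_of_pos (by omega), if_neg (by omega)] at h0
        simp only at h1
        rw [abs_of_nonneg (by omega)] at h0
        omega
    refine ha.imp (fun ha => funext fun i => ?_) (fun ha => funext fun i => ?_) <;>
    · rw [hi i, ha]; ring
  · have key (a : ℤ) (ha : a = 0 ∨ a = 1) (hka : ∀ i, k i = a - m + (i : ℕ)) :
        ∑ i, |2 * k i - 1| = 2 * (m : ℤ) * (m + 1) + 1 := by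
      rw [← sum_centered_abs m a]
      refine Finset.sum_congr rfl fun i _ => ?_
      rw [hka i]
      rcases lt_trichotomy (i : ℕ) m with h | h | h
      · rw [abs_of_neg (by omega : ((i : ℕ) : ℤ) - m < 0), Int.sign_eq_neg_one_of_neg (by omega),
          if_neg (by omega), abs_of_nonpos (by omega)]
        omega
      · rw [h]
        rcases ha with rfl | rfl <;> simp
      · rw [abs_of_pos (by omega : 0 < ((i : ℕ) : ℤ) - m), Int.sign_eq_one_of_pos (by omega),
          if_neg (by omega), abs_of_nonneg (by omega)]
        omega
    rintro (h | h)
    · exact key 0 (.inl rfl) fun i => by rw [h]; ring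
    · exact key 1 (.inr rfl) fun i => by rw [h]; ring

lemma sum_abs_half_sub {n : ℕ} (k : Fin n → ℤ) :
    ∑ i, |1 / 2 - (k i : ℝ)| = ((∑ i, |2 * k i - 1| : ℤ) : ℝ) / 2 := by
  push_cast
  rw [Finset.sum_div]
  refine Finset.sum_congr rfl fun i _ => ?_
  rw [← abs_neg, show -(1 / 2 - (k i : ℝ)) = (2 * k i - 1) / 2 by ring, abs_div, abs_two]

lemma norm_det_le_factorial {n : ℕ} {A : Matrix (Fin n) (Fin n) ℂ} (hA : ∀ i j, ‖A i j‖ ≤ 1) :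
    ‖A.det‖ ≤ (n.factorial : ℝ) := by
  have := Matrix.det_le (A := A) (abv := NormedField.toAbsoluteValue ℂ) (x := 1) hA
  rwa [Fintype.card_fin, one_pow, nsmul_one] at this

/-- The `r`-independent product of the two Fourier determinants at `β = 1/2`. -/
noncomputable def fourierDetProd {n : ℕ} (θ φ : Fin n → ℝ) (k : Fin n → ℤ) : ℂ :=
  (Matrix.of fun i j : Fin n =>
      Complex.exp (Complex.I * (((1 / 2 : ℝ) : ℂ) - (k i : ℂ)) * (θ j : ℂ))).det *
  (Matrix.of fun i j : Fin n =>
      Complex.exp (-Complex.I * (((1 / 2 : ℝ) : ℂ) - (k i : ℂ)) * (φ j : ℂ))).det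

lemma norm_fourierDetProd_le {n : ℕ} (θ φ : Fin n → ℝ) (k : Fin n → ℤ) :
    ‖fourierDetProd θ φ k‖ ≤ (n.factorial : ℝ) * n.factorial := by
  rw [fourierDetProd, norm_mul]
  gcongr <;> refine norm_det_le_factorial fun i j => le_of_eq ?_
  · rw [Matrix.of_apply, Complex.norm_exp]
    simp
  · rw [Matrix.of_apply, Complex.norm_exp]
    simp

lemma rpow_mul_annulusTerm {n : ℕ} (θ φ : Fin n → ℝ) (k : Fin n → ℤ) {r : ℝ} (hr : 0 < r)
    (E : ℝ) :
    ((r ^ (-E) : ℝ) : ℂ) * annulusTerm n (1 / 2) r θ φ k =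
      fourierDetProd θ φ k * ((r ^ (∑ i, |1 / 2 - (k i : ℝ)| - E) *
        ∏ i, (2 / (1 + r ^ (2 * |1 / 2 - (k i : ℝ)|))) : ℝ) : ℂ) := by
  rw [annulusTerm, ← fourierDetProd, mul_left_comm]
  congr 1
  simp only [sech_log_one_div_mul hr]
  rw [← Complex.ofReal_prod, ← Complex.ofReal_mul, Finset.prod_mul_distrib,
    ← Real.rpow_sum_of_pos hr, ← mul_assoc, ← Real.rpow_add hr]
  congr 3
  ring

lemma abs_half_sub_intCast_pos (k : ℤ) : 0 < |1 / 2 - (k : ℝ)| := by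
  rw [abs_pos]
  intro h
  have h2 : (2 * k : ℝ) = 1 := by linarith
  have h3 : 2 * k = 1 := by exact_mod_cast h2
  omega

lemma tendsto_rpow_nhdsWithin_Ioo {a : ℝ} (ha : 0 < a) :
    Filter.Tendsto (fun r : ℝ => r ^ a) (nhdsWithin 0 (Set.Ioo (0 : ℝ) 1)) (nhds 0) := by
  have h := (Real.continuousAt_rpow_const 0 a (.inr ha.le)).tendsto
  rw [Real.zero_rpow ha.ne'] at h
  exact h.mono_left nhdsWithin_le_nhds

lemma tendsto_prod_two_div {n : ℕ} (k : Fin n → ℤ) :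
    Filter.Tendsto (fun r : ℝ => ∏ i, (2 / (1 + r ^ (2 * |1 / 2 - (k i : ℝ)|))))
      (nhdsWithin 0 (Set.Ioo (0 : ℝ) 1)) (nhds (2 ^ n)) := by
  have h := tendsto_finsetProd (M := ℝ) (x := nhdsWithin 0 (Set.Ioo (0 : ℝ) 1))
    (f := fun (i : Fin n) (r : ℝ) => 2 / (1 + r ^ (2 * |1 / 2 - (k i : ℝ)|)))
    (a := fun _ => 2) Finset.univ (fun i _ => by
      have h1 := (tendsto_rpow_nhdsWithin_Ioo (mul_pos two_pos
        (abs_half_sub_intCast_pos (k i)))).const_add 1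
      have h2 := (tendsto_const_nhds (x := (2 : ℝ))).div h1 (by norm_num)
      rw [add_zero, div_one] at h2
      exact h2)
  simpa using h

lemma sum_sum_Ioi_add {n : ℕ} (f : Fin n → ℂ) :
    ∑ i, ∑ j ∈ Finset.Ioi i, (f i + f j) = ((n : ℂ) - 1) * ∑ i, f i := by
  have h : ∑ i, ∑ j ∈ Finset.Ioi i, f j = ∑ j, ∑ i ∈ Finset.Iio j, f j :=
    Finset.sum_comm' (by simp)
  simp only [Finset.sum_add_distrib]
  rw [h, ← Finset.sum_add_distrib, Finset.mul_sum]
  refine Finset.sum_congr rfl fun i _ => ?_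
  simp only [Finset.sum_const, Fin.card_Ioi, Fin.card_Iio, nsmul_eq_mul]
  rw [← add_mul, Nat.sub_sub, Nat.cast_sub (by omega)]
  push_cast; ring

lemma exp_sub_exp_eq_norm_mul {x y : ℝ} (hxy : x ≤ y) (hyx : y ≤ x + 2 * Real.pi) :
    Complex.exp (Complex.I * y) - Complex.exp (Complex.I * x) =
      (‖Complex.exp (Complex.I * y) - Complex.exp (Complex.I * x)‖ : ℂ) *
        (Complex.I * Complex.exp (Complex.I * ((x + y) / 2))) := by
  have hs : 0 ≤ Real.sin ((y - x) / 2) :=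
    Real.sin_nonneg_of_nonneg_of_le_pi (by linarith) (by linarith)
  have key : Complex.exp (Complex.I * y) - Complex.exp (Complex.I * x) =
      ((2 * Real.sin ((y - x) / 2) : ℝ) : ℂ) *
        (Complex.I * Complex.exp (Complex.I * ((x + y) / 2))) := by
    have hI : Complex.I * Complex.I = -1 := Complex.I_mul_I
    have e1 : Complex.I * (y : ℂ) = Complex.I * ((x + y) / 2) + ((y - x) / 2 : ℂ) * Complex.I := by
      ring
    have e2 : Complex.I * (x : ℂ) =
        Complex.I * ((x + y) / 2) + -((y - x) / 2 : ℂ) * Complex.I := by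
      ring
    rw [e1, e2, Complex.exp_add, Complex.exp_add]
    push_cast
    rw [Complex.sin]
    linear_combination (Complex.exp (Complex.I * ((x + y) / 2)) *
      (Complex.exp ((y - x) / 2 * Complex.I) - Complex.exp (-((y - x) / 2) * Complex.I))) * hI
  have hn : ‖Complex.exp (Complex.I * y) - Complex.exp (Complex.I * x)‖ =
      2 * Real.sin ((y - x) / 2) := by
    rw [key, norm_mul, norm_mul, Complex.norm_I, one_mul, Complex.norm_exp,
      Complex.norm_of_nonneg (by positivity)]
    have : (Complex.I * (((x : ℂ) + y) / 2)).re = 0 := by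
      rw [← Complex.ofReal_add, Complex.I_mul_re]
      simp
    simp [this]
  rw [hn]
  exact key

lemma Vprod_eq_prod_Ioi (n : ℕ) (θ : Fin n → ℝ) :
    Vprod n θ = ∏ i, ∏ j ∈ Finset.Ioi i,
      ‖Complex.exp (Complex.I * (θ j : ℂ)) - Complex.exp (Complex.I * (θ i : ℂ))‖ := by
  rw [Vprod, Finset.prod_filter, ← Finset.univ_product_univ, Finset.prod_product]
  refine Finset.prod_congr rfl fun i _ => ?_
  rw [← Finset.prod_filter]
  exact Finset.prod_congr (by ext; simp) fun _ _ => rfl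

lemma det_vandermonde_exp {n : ℕ} {θ : Fin n → ℝ} (hθ : CyclicallyOrdered θ) :
    (Matrix.vandermonde fun j => Complex.exp (Complex.I * (θ j : ℂ))).det =
      Complex.I ^ (∑ i : Fin n, (Finset.Ioi i).card) * Vprod n θ *
        Complex.exp (Complex.I * (((n : ℂ) - 1) / 2 * ∑ j, (θ j : ℂ))) := by
  have h (i : Fin n) : ∏ j ∈ Finset.Ioi i,
      (Complex.exp (Complex.I * (θ j : ℂ)) - Complex.exp (Complex.I * (θ i : ℂ))) =
      ∏ j ∈ Finset.Ioi i,
      ((‖Complex.exp (Complex.I * (θ j : ℂ)) - Complex.exp (Complex.I * (θ i : ℂ))‖ : ℂ) *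
        (Complex.I * Complex.exp (Complex.I * ((θ i + θ j) / 2)))) :=
    Finset.prod_congr rfl fun j hj =>
      exp_sub_exp_eq_norm_mul (hθ.1.monotone (Finset.mem_Ioi.1 hj).le) (hθ.2 j i).le
  rw [Matrix.det_vandermonde, Vprod_eq_prod_Ioi]
  simp only [h, Finset.prod_mul_distrib, Finset.prod_const, ← Complex.exp_sum]
  rw [Finset.prod_pow_eq_pow_sum]
  push_cast
  have e : ∑ i, ∑ j ∈ Finset.Ioi i, Complex.I * (((θ i : ℂ) + θ j) / 2) =
      Complex.I * (((n : ℂ) - 1) / 2 * ∑ j, (θ j : ℂ)) := by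
    have := sum_sum_Ioi_add fun j => (θ j : ℂ)
    simp only [← Finset.mul_sum, ← Finset.sum_div, this]
    ring
  rw [e]
  ring

lemma det_exp_arith {n : ℕ} (b : ℂ) {φ : Fin n → ℝ} (hφ : CyclicallyOrdered φ) :
    (Matrix.of fun i j : Fin n =>
      Complex.exp (-Complex.I * (b - ((i : ℕ) : ℂ)) * (φ j : ℂ))).det =
      Complex.I ^ (∑ i : Fin n, (Finset.Ioi i).card) * Vprod n φ *
        Complex.exp (Complex.I * ((((n : ℂ) - 1) / 2 - b) * ∑ j, (φ j : ℂ))) := by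
  have h : (Matrix.of fun i j : Fin n =>
      Complex.exp (-Complex.I * (b - ((i : ℕ) : ℂ)) * (φ j : ℂ))) =
      Matrix.of fun i j : Fin n => Complex.exp (-Complex.I * b * φ j) *
        (Matrix.vandermonde fun j => Complex.exp (Complex.I * (φ j : ℂ))).transpose i j := by
    ext i j
    rw [Matrix.of_apply, Matrix.of_apply, Matrix.transpose_apply, Matrix.vandermonde_apply,
      ← Complex.exp_nat_mul, ← Complex.exp_add]
    congr 1
    ring
  rw [h, Matrix.det_mul_row, Matrix.det_transpose, det_vandermonde_exp hφ, ← Complex.exp_sum,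
    mul_left_comm, ← Complex.exp_add, ← Finset.mul_sum]
  congr 2
  ring

lemma det_exp_arith_conj {n : ℕ} (b : ℝ) {θ : Fin n → ℝ} (hθ : CyclicallyOrdered θ) :
    (Matrix.of fun i j : Fin n =>
      Complex.exp (Complex.I * ((b : ℂ) - ((i : ℕ) : ℂ)) * (θ j : ℂ))).det =
      (-Complex.I) ^ (∑ i : Fin n, (Finset.Ioi i).card) * Vprod n θ *
        Complex.exp (-Complex.I * ((((n : ℂ) - 1) / 2 - b) * ∑ j, (θ j : ℂ))) := by
  have h := congrArg (starRingEnd ℂ) (det_exp_arith (b : ℂ) hθ)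
  rw [RingHom.map_det] at h
  convert h using 1
  · congr 1
    ext i j
    simp [← Complex.exp_conj]
  · have h2 : (starRingEnd ℂ) 2 = 2 := Complex.conj_ofNat 2
    simp [← Complex.exp_conj, h2]

lemma fourierDetProd_arith {n : ℕ} {θ φ : Fin n → ℝ} (hθ : CyclicallyOrdered θ)
    (hφ : CyclicallyOrdered φ) (a : ℤ) :
    fourierDetProd θ φ (fun i => a + (i : ℕ)) = Vprod n θ * Vprod n φ *
      Complex.exp ((1 - (n : ℂ) / 2 - a) * (∑ j, (θ j : ℂ) - ∑ j, (φ j : ℂ)) * Complex.I) := by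
  have h1 := det_exp_arith_conj (1 / 2 - (a : ℝ)) hθ
  have h2 := det_exp_arith ((1 / 2 - (a : ℝ) : ℝ) : ℂ) hφ
  have e (i : ℕ) : ((1 / 2 : ℝ) : ℂ) - ((a + (i : ℕ) : ℤ) : ℂ) =
      ((1 / 2 - (a : ℝ) : ℝ) : ℂ) - (i : ℂ) := by push_cast; ring
  simp only [fourierDetProd, e]
  rw [h1, h2]
  have hI : (-Complex.I) ^ (∑ i : Fin n, (Finset.Ioi i).card) *
      Complex.I ^ (∑ i : Fin n, (Finset.Ioi i).card) = 1 := by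
    rw [← mul_pow]; simp
  have he : Complex.exp ((1 - (n : ℂ) / 2 - a) * (∑ j, (θ j : ℂ) - ∑ j, (φ j : ℂ)) * Complex.I) =
      Complex.exp (-Complex.I * ((((n : ℂ) - 1) / 2 - ((1 / 2 - (a : ℝ) : ℝ) : ℂ)) *
        ∑ j, (θ j : ℂ))) *
      Complex.exp (Complex.I * ((((n : ℂ) - 1) / 2 - ((1 / 2 - (a : ℝ) : ℝ) : ℂ)) *
        ∑ j, (φ j : ℂ))) := by
    rw [← Complex.exp_add]
    congr 1
    push_cast
    ring
  rw [he, ← one_mul ((Vprod n θ : ℂ) * Vprod n φ), ← hI]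
  ring

/-- The pointwise limit of the rescaled general term. -/
lemma tendsto_rpow_mul_annulusTerm {n : ℕ} (θ φ : Fin n → ℝ) (k : Fin n → ℤ) {E : ℝ}
    (hE : E ≤ ∑ i, |1 / 2 - (k i : ℝ)|) :
    Filter.Tendsto (fun r : ℝ => ((r ^ (-E) : ℝ) : ℂ) * annulusTerm n (1 / 2) r θ φ k)
      (nhdsWithin 0 (Set.Ioo (0 : ℝ) 1))
      (nhds (if ∑ i, |1 / 2 - (k i : ℝ)| = E then fourierDetProd θ φ k * 2 ^ n else 0)) := by
  have h1 : Filter.Tendsto (fun r : ℝ => r ^ (∑ i, |1 / 2 - (k i : ℝ)| - E))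
      (nhdsWithin 0 (Set.Ioo (0 : ℝ) 1))
      (nhds (if ∑ i, |1 / 2 - (k i : ℝ)| = E then 1 else 0)) := by
    split_ifs with h
    · simp only [h, sub_self, Real.rpow_zero]
      exact tendsto_const_nhds
    · exact tendsto_rpow_nhdsWithin_Ioo (sub_pos.2 (lt_of_le_of_ne hE (Ne.symm h)))
  have h2 := ((Complex.continuous_ofReal.tendsto _).comp
    (h1.mul (tendsto_prod_two_div k))).const_mul (fourierDetProd θ φ k)
  have h3 : (if ∑ i, |1 / 2 - (k i : ℝ)| = E then fourierDetProd θ φ k * 2 ^ n else 0) =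
      fourierDetProd θ φ k *
        (((if ∑ i, |1 / 2 - (k i : ℝ)| = E then 1 else 0) * 2 ^ n : ℝ) : ℂ) := by
    split_ifs <;> simp
  rw [h3]
  refine h2.congr' ?_
  filter_upwards [self_mem_nhdsWithin] with r hr
  rw [rpow_mul_annulusTerm θ φ k hr.1]
  rfl

lemma norm_rpow_mul_annulusTerm_le {n : ℕ} (θ φ : Fin n → ℝ) (k : Fin n → ℤ) {E : ℝ}
    (hE : E ≤ ∑ i, |1 / 2 - (k i : ℝ)|) {r : ℝ} (hr : 0 < r) (hr' : r ≤ 1 / 2) :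
    ‖((r ^ (-E) : ℝ) : ℂ) * annulusTerm n (1 / 2) r θ φ k‖ ≤
      ((n.factorial : ℝ) * n.factorial * 2 ^ n * (1 / 2) ^ (-E)) *
        ∏ i, (1 / 2 : ℝ) ^ |1 / 2 - (k i : ℝ)| := by
  have h1 : r ^ (∑ i, |1 / 2 - (k i : ℝ)| - E) ≤
      (1 / 2) ^ (-E) * ∏ i, (1 / 2 : ℝ) ^ |1 / 2 - (k i : ℝ)| := by
    rw [← Real.rpow_sum_of_pos (by norm_num), ← Real.rpow_add (by norm_num), neg_add_eq_sub]
    exact Real.rpow_le_rpow hr.le hr' (sub_nonneg.2 hE)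
  have h2 : ∏ i, (2 / (1 + r ^ (2 * |1 / 2 - (k i : ℝ)|))) ≤ 2 ^ n := by
    calc ∏ i, (2 / (1 + r ^ (2 * |1 / 2 - (k i : ℝ)|))) ≤ ∏ _i : Fin n, (2 : ℝ) :=
          Finset.prod_le_prod (fun i _ => by positivity) fun i _ =>
            div_le_self zero_le_two (by linarith [Real.rpow_nonneg hr.le (2 * |1 / 2 - (k i : ℝ)|)])
      _ = 2 ^ n := by simp
  rw [rpow_mul_annulusTerm θ φ k hr, norm_mul, Complex.norm_of_nonneg (by positivity)]
  calc _ ≤ ((n.factorial : ℝ) * n.factorial) *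
        (((1 / 2) ^ (-E) * ∏ i, (1 / 2 : ℝ) ^ |1 / 2 - (k i : ℝ)|) * 2 ^ n) := by
        gcongr
        exact norm_fourierDetProd_le θ φ k
    _ = _ := by ring

lemma tendsto_tsum_annulusTerm {n : ℕ} (θ φ : Fin n → ℝ) {E : ℝ}
    (hE : ∀ k : Fin n → ℤ, StrictMono k → E ≤ ∑ i, |1 / 2 - (k i : ℝ)|) :
    Filter.Tendsto (fun r : ℝ => ∑' k : {k : Fin n → ℤ // StrictMono k},
        ((r ^ (-E) : ℝ) : ℂ) * annulusTerm n (1 / 2) r θ φ k.1)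
      (nhdsWithin 0 (Set.Ioo (0 : ℝ) 1))
      (nhds (∑' k : {k : Fin n → ℤ // StrictMono k},
        if ∑ i, |1 / 2 - (k.1 i : ℝ)| = E then fourierDetProd θ φ k.1 * 2 ^ n else 0)) := by
  refine tendsto_tsum_of_dominated_convergence
    (((summable_prod_fin_of_nonneg (fun k => by positivity)
      summable_half_rpow_abs_half_sub n).mul_left
      ((n.factorial : ℝ) * n.factorial * 2 ^ n * (1 / 2) ^ (-E))).comp_injective Subtype.val_injective)
    (fun k => tendsto_rpow_mul_annulusTerm θ φ k.1 (hE k.1 k.2)) ?_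
  filter_upwards [self_mem_nhdsWithin,
    nhdsWithin_le_nhds (Iic_mem_nhds (show (0 : ℝ) < 1 / 2 by norm_num))] with r hr hr' k
  exact norm_rpow_mul_annulusTerm_le θ φ k.1 (hE k.1 k.2) hr.1 hr'

lemma strictMono_arith {n : ℕ} (a : ℤ) : StrictMono fun i : Fin n => a + ((i : ℕ) : ℤ) :=
  fun i j hij => by
    have : (i : ℕ) < j := hij
    simp only
    omega

/-- odd `n`, `β = 1/2` asymptotics of the annulus determinant as `r → 0`. -/
theorem annulusD_tendsto_odd_half (n : ℕ) (hn : 1 ≤ n) (hodd : Odd n)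
    (θ φ : Fin n → ℝ) (hθ : CyclicallyOrdered θ) (hφ : CyclicallyOrdered φ) :
    Filter.Tendsto
      (fun r : ℝ =>
        ((r ^ (-(((n : ℝ) ^ 2 - 1) / 4 + 1 / 2)) : ℝ) : ℂ) *
          annulusD n (1 / 2) r θ φ)
      (nhdsWithin 0 (Set.Ioo (0 : ℝ) 1))
      (nhds (((Real.pi : ℂ) ^ n)⁻¹ *
        ((2 * Real.cos ((∑ j, θ j - ∑ j, φ j) / 2) : ℝ) : ℂ) *
        (Vprod n θ : ℂ) * (Vprod n φ : ℂ))) := by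
  obtain ⟨m, rfl⟩ := hodd
  set E : ℝ := (((2 * m + 1 : ℕ) : ℝ) ^ 2 - 1) / 4 + 1 / 2 with hE
  have hE' : E = ((2 * (m : ℤ) * (m + 1) + 1 : ℤ) : ℝ) / 2 := by
    rw [hE]; push_cast; ring
  have hle (k : Fin (2 * m + 1) → ℤ) (hk : StrictMono k) :
      E ≤ ∑ i, |1 / 2 - (k i : ℝ)| := by
    rw [sum_abs_half_sub, hE']
    exact div_le_div_of_nonneg_right (Int.cast_le.2 (le_sum_abs_of_strictMono hk)) zero_le_two
  have heq (k : Fin (2 * m + 1) → ℤ) (hk : StrictMono k) :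
      ∑ i, |1 / 2 - (k i : ℝ)| = E ↔
        (k = fun i : Fin (2 * m + 1) => -(m : ℤ) + (i : ℕ)) ∨
          k = fun i : Fin (2 * m + 1) => -(m : ℤ) + 1 + (i : ℕ) := by
    rw [← sum_abs_eq_iff hk, sum_abs_half_sub, hE', div_left_inj' two_ne_zero, Int.cast_inj]
  let k₀ : {k : Fin (2 * m + 1) → ℤ // StrictMono k} := ⟨_, strictMono_arith (-(m : ℤ))⟩
  let k₁ : {k : Fin (2 * m + 1) → ℤ // StrictMono k} := ⟨_, strictMono_arith (-(m : ℤ) + 1)⟩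
  have hne : k₀ ≠ k₁ := fun h => by
    have := congrFun (congrArg Subtype.val h) 0
    simp [k₀, k₁] at this
  have hsum : (∑' k : {k : Fin (2 * m + 1) → ℤ // StrictMono k},
      if ∑ i, |1 / 2 - (k.1 i : ℝ)| = E then fourierDetProd θ φ k.1 * 2 ^ (2 * m + 1) else 0) =
      (fourierDetProd θ φ k₀.1 + fourierDetProd θ φ k₁.1) * 2 ^ (2 * m + 1) := by
    rw [tsum_eq_sum (s := {k₀, k₁}), Finset.sum_pair hne, if_pos ((heq _ k₀.2).2 (.inl rfl)),
      if_pos ((heq _ k₁.2).2 (.inr rfl)), add_mul]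
    intro k hk
    refine if_neg fun h => hk ?_
    rw [Finset.mem_insert, Finset.mem_singleton]
    exact ((heq k.1 k.2).1 h).imp Subtype.ext Subtype.ext
  have hlim := (tendsto_tsum_annulusTerm θ φ hle).const_mul
    (((2 * Real.pi : ℝ) : ℂ)⁻¹ ^ (2 * m + 1))
  rw [hsum, fourierDetProd_arith hθ hφ, fourierDetProd_arith hθ hφ] at hlim
  convert hlim using 1
  · funext r
    rw [annulusD, tsum_mul_left]
    ring
  · congr 1
    have hcos : ((2 * Real.cos ((∑ j, θ j - ∑ j, φ j) / 2) : ℝ) : ℂ) =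
        Complex.exp ((1 - ((2 * m + 1 : ℕ) : ℂ) / 2 - (-(m : ℤ) : ℤ)) *
          (∑ j, (θ j : ℂ) - ∑ j, (φ j : ℂ)) * Complex.I) +
        Complex.exp ((1 - ((2 * m + 1 : ℕ) : ℂ) / 2 - (-(m : ℤ) + 1 : ℤ)) *
          (∑ j, (θ j : ℂ) - ∑ j, (φ j : ℂ)) * Complex.I) := by
      push_cast
      rw [Complex.two_cos]
      congr 2 <;> ring
    have hpi : (Real.pi : ℂ) ≠ 0 := Complex.ofReal_ne_zero.2 Real.pi_ne_zero
    have h2pi : ((Real.pi : ℂ) ^ (2 * m + 1))⁻¹ =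
        ((2 * Real.pi : ℝ) : ℂ)⁻¹ ^ (2 * m + 1) * 2 ^ (2 * m + 1) := by
      push_cast
      rw [← inv_pow, ← mul_pow]
      congr 1
      field_simp
    rw [hcos, h2pi]
    ring
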